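/- arXiv:2402.04244 — 2 statements merged into one kernel-verified Lean document; each statement's English description precedes it below -/
import Mathlib

section
/- Let C be a preadditive category with finite biproducts, D a preadditive category, F : C ⥤ D an arbitrary functor, d a positive integer, x : Fin d → C with biproduct X, and for U ⊆ Fin d let cr(U) := ∑_{V ⊆ U} (−1)^{|U|−|V|} F.map(ψ_V) ∈ End(F(X)). Then the endomorphisms cr(U), as U ranges over all finite subsets of Fin d, are pairwise orthogonal idempotents whose sum is the identity: cr(U) ≫ cr(U) = cr(U) for every U, cr(U) ≫ cr(U') = 0 whenever U ≠ U', and ∑_{U ⊆ Fin d} cr(U) = 𝟙_{F(X)}. -/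
open CategoryTheory CategoryTheory.Limits

/-- `psi x U = ∑_{i ∈ U} π_i ≫ ι_i`, an endomorphism of the biproduct `⨁ x`. -/
noncomputable def psi {C : Type*} [Category C] [Preadditive C] [HasFiniteBiproducts C]
    {d : ℕ} (x : Fin d → C) (U : Finset (Fin d)) : (⨁ x) ⟶ (⨁ x) :=
  ∑ i ∈ U, biproduct.π x i ≫ biproduct.ι x i

/-- `cr F x U = ∑_{V ⊆ U} (−1)^{|U|−|V|} F.map (ψ_V)`, an endomorphism of `F(⨁ x)`. -/
noncomputable def cr {C : Type*} [Category C] [Preadditive C] [HasFiniteBiproducts C]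
    {D : Type*} [Category D] [Preadditive D] {d : ℕ} (F : C ⥤ D) (x : Fin d → C)
    (U : Finset (Fin d)) : F.obj (⨁ x) ⟶ F.obj (⨁ x) :=
  ∑ V ∈ U.powerset, ((-1 : ℤ) ^ (U.card - V.card)) • F.map (psi x V)

section AlternatingSum

variable {α A : Type*} [DecidableEq α] [AddCommGroup A]

/-- The Möbius transform of `g` on the lattice of finite sets:
the alternating sum of `g` over the subsets of `U`. -/
def alternatingSum (g : Finset α → A) (U : Finset α) : A :=
  ∑ V ∈ U.powerset, ((-1 : ℤ) ^ (U.card - V.card)) • g V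

theorem alternatingSum_insert (g : Finset α → A) {a : α} {U : Finset α} (ha : a ∉ U) :
    alternatingSum g (insert a U) =
      alternatingSum (fun V ↦ g (insert a V)) U - alternatingSum g U := by
  unfold alternatingSum
  rw [Finset.sum_powerset_insert ha, sub_eq_neg_add, ← Finset.sum_neg_distrib]
  congr 1 <;> refine Finset.sum_congr rfl fun V hV ↦ ?_
  · have hVU := Finset.card_le_card (Finset.mem_powerset.1 hV)
    rw [Finset.card_insert_of_notMem ha, Nat.succ_sub hVU, pow_succ, mul_neg_one, neg_smul]
  · have haV : a ∉ V := fun h ↦ ha (Finset.mem_powerset.1 hV h)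
    rw [Finset.card_insert_of_notMem ha, Finset.card_insert_of_notMem haV,
      Nat.add_sub_add_right]

/-- Möbius inversion on the lattice of finite sets. -/
theorem sum_powerset_alternatingSum (g : Finset α → A) (W : Finset α) :
    ∑ U ∈ W.powerset, alternatingSum g U = g W := by
  induction W using Finset.induction_on generalizing g with
  | empty => simp [alternatingSum]
  | insert a s ha ih =>
    rw [Finset.sum_powerset_insert ha, ← ih fun V ↦ g (insert a V), ← Finset.sum_add_distrib]
    refine Finset.sum_congr rfl fun U hU ↦ ?_
    rw [alternatingSum_insert g fun h ↦ ha (Finset.mem_powerset.1 hU h), add_sub_cancel]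

theorem alternatingSum_inter_of_subset (g : Finset α → A) {U W : Finset α} (h : U ⊆ W) :
    alternatingSum (fun V ↦ g (V ∩ W)) U = alternatingSum g U := by
  refine Finset.sum_congr rfl fun V hV ↦ ?_
  simp only [Finset.inter_eq_left.2 ((Finset.mem_powerset.1 hV).trans h)]

theorem alternatingSum_inter_of_not_subset (g : Finset α → A) {U W : Finset α} (h : ¬U ⊆ W) :
    alternatingSum (fun V ↦ g (V ∩ W)) U = 0 := by
  obtain ⟨a, haU, haW⟩ := Finset.not_subset.1 h
  rw [← Finset.insert_erase haU, alternatingSum_insert _ (Finset.notMem_erase a U)]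
  simp only [Finset.insert_inter_of_notMem haW, sub_self]

end AlternatingSum

section CrossEffect

variable {C : Type*} [Category C] [Preadditive C] [HasFiniteBiproducts C]
  {D : Type*} [Category D] [Preadditive D] {d : ℕ} (F : C ⥤ D) (x : Fin d → C)

theorem psi_comp_psi (V W : Finset (Fin d)) : psi x V ≫ psi x W = psi x (V ∩ W) := by
  simp only [psi, Preadditive.sum_comp, Preadditive.comp_sum]
  rw [Finset.sum_comm, ← Finset.filter_mem_eq_inter, Finset.sum_filter]
  refine Finset.sum_congr rfl fun i _ ↦ ?_
  have key (j : Fin d) : (biproduct.π x i ≫ biproduct.ι x i) ≫ biproduct.π x j ≫ biproduct.ι x j =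
      if i = j then biproduct.π x i ≫ biproduct.ι x i else 0 := by
    split_ifs with hij
    · subst hij
      simp
    · simp [biproduct.ι_π_ne_assoc x hij]
  simp only [key, Finset.sum_ite_eq]

theorem psi_univ : psi x Finset.univ = 𝟙 (⨁ x) :=
  biproduct.total

theorem cr_eq_alternatingSum (U : Finset (Fin d)) :
    cr F x U = alternatingSum (fun V ↦ F.map (psi x V)) U :=
  rfl

theorem cr_comp_map_psi (U W : Finset (Fin d)) :
    cr F x U ≫ F.map (psi x W) = if U ⊆ W then cr F x U else 0 := by
  have h : cr F x U ≫ F.map (psi x W) = alternatingSum (fun V ↦ F.map (psi x (V ∩ W))) U := by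
    simp only [cr, alternatingSum, Preadditive.sum_comp, Preadditive.zsmul_comp, ← F.map_comp,
      psi_comp_psi]
  rw [h]
  split_ifs with hUW
  · exact alternatingSum_inter_of_subset (fun V ↦ F.map (psi x V)) hUW
  · exact alternatingSum_inter_of_not_subset (fun V ↦ F.map (psi x V)) hUW

theorem cr_comp_cr_comm (U U' : Finset (Fin d)) :
    cr F x U ≫ cr F x U' = cr F x U' ≫ cr F x U := by
  simp only [cr, Preadditive.sum_comp, Preadditive.comp_sum, Preadditive.zsmul_comp,
    Preadditive.comp_zsmul, ← F.map_comp, psi_comp_psi, Finset.smul_sum]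
  rw [Finset.sum_comm]
  refine Finset.sum_congr rfl fun V _ ↦ Finset.sum_congr rfl fun W _ ↦ ?_
  rw [smul_comm, Finset.inter_comm]

theorem cr_comp_cr (U U' : Finset (Fin d)) :
    cr F x U ≫ cr F x U' = ∑ V ∈ U'.powerset,
      ((-1 : ℤ) ^ (U'.card - V.card)) • if U ⊆ V then cr F x U else 0 := by
  conv_lhs => rw [cr.eq_1 F x U']
  simp only [Preadditive.comp_sum, Preadditive.comp_zsmul, cr_comp_map_psi]

theorem cr_comp_cr_self (U : Finset (Fin d)) : cr F x U ≫ cr F x U = cr F x U := by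
  rw [cr_comp_cr, Finset.sum_eq_single_of_mem U (Finset.mem_powerset_self U)]
  · simp
  · intro V hV hne
    rw [if_neg fun h ↦ hne ((Finset.mem_powerset.1 hV).antisymm h), smul_zero]

theorem cr_comp_cr_of_not_subset {U U' : Finset (Fin d)} (h : ¬U ⊆ U') :
    cr F x U ≫ cr F x U' = 0 := by
  rw [cr_comp_cr]
  refine Finset.sum_eq_zero fun V hV ↦ ?_
  rw [if_neg fun hUV ↦ h (hUV.trans (Finset.mem_powerset.1 hV)), smul_zero]

theorem cr_comp_cr_of_ne {U U' : Finset (Fin d)} (h : U ≠ U') :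
    cr F x U ≫ cr F x U' = 0 := by
  by_cases hsub : U ⊆ U'
  · rw [cr_comp_cr_comm]
    exact cr_comp_cr_of_not_subset F x fun h' ↦ h (hsub.antisymm h')
  · exact cr_comp_cr_of_not_subset F x hsub

theorem sum_cr : ∑ U : Finset (Fin d), cr F x U = 𝟙 (F.obj (⨁ x)) := by
  rw [← Finset.powerset_univ]
  simp only [cr_eq_alternatingSum]
  rw [sum_powerset_alternatingSum, psi_univ, F.map_id]

end CrossEffect

/-- The endomorphisms `cr U`, as `U` ranges over all finite subsets of `Fin d`, are pairwise
orthogonal idempotents whose sum is the identity. -/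
theorem cr_orthogonal_idempotents {C : Type*} [Category C] [Preadditive C]
    [HasFiniteBiproducts C] {D : Type*} [Category D] [Preadditive D] {d : ℕ} (hd : 0 < d)
    (F : C ⥤ D) (x : Fin d → C) :
    (∀ U : Finset (Fin d), cr F x U ≫ cr F x U = cr F x U) ∧
    (∀ U U' : Finset (Fin d), U ≠ U' → cr F x U ≫ cr F x U' = 0) ∧
    ∑ U : Finset (Fin d), cr F x U = 𝟙 (F.obj (⨁ x)) := by
  exact ⟨cr_comp_cr_self F x, fun _ _ ↦ cr_comp_cr_of_ne F x, sum_cr F x⟩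
end

section
/- Let p be a prime and let k > l ≥ 1 be integers. Then: (1) there exists a chain of p-power partitions from k to l if and only if p − 1 divides k − l; (2) if p − 1 divides k − l and l ≥ s_p(k), then the minimal length of a chain of p-power partitions from k to l is 1 (i.e., k is itself a sum of l powers of p); (3) if p − 1 divides k − l and l < s_p(k), then the minimal length of a chain of p-power partitions from k to l is 2 (i.e., k is not a sum of l powers of p, but there exists an integer m with l < m < k such that k is a sum of m powers of p and m is a sum of l powers of p). -/
/-- `k` is a sum of `l` powers of `p` if there is `f : Fin l → ℕ` with `k = ∑ t, p ^ f t`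
(the power `p^0 = 1` is allowed). -/
def IsSumPowers (p k l : ℕ) : Prop :=
  ∃ f : Fin l → ℕ, k = ∑ t, p ^ (f t)

/-- A chain of `p`-power partitions from `k` to `l` of length `s` is a strictly increasing
sequence `l = c 0 < c 1 < … < c s = k` such that each `c (α+1)` is a sum of `c α` powers
of `p`. -/
def IsPChain (p k l s : ℕ) : Prop :=
  ∃ c : ℕ → ℕ, c 0 = l ∧ c s = k ∧ (∀ α, α < s → c α < c (α + 1)) ∧
    ∀ α, α < s → IsSumPowers p (c (α + 1)) (c α)

theorem digits_sum_add_le (p : ℕ) (hp : p.Prime) (a b : ℕ) :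
    (Nat.digits p (a + b)).sum ≤ (Nat.digits p a).sum + (Nat.digits p b).sum := by
  have := Fact.mk hp
  have hab := sub_one_mul_padicValNat_factorial (p := p) (a + b)
  have ha := sub_one_mul_padicValNat_factorial (p := p) a
  have hb := sub_one_mul_padicValNat_factorial (p := p) b
  have hdvd := padicValNat_dvd_iff_le (p := p) (Nat.factorial_ne_zero (a + b)) |>.mp
    (pow_padicValNat_dvd.trans (Nat.factorial_mul_factorial_dvd_factorial_add a b))
  rw [padicValNat.mul (Nat.factorial_ne_zero a) (Nat.factorial_ne_zero b)] at hdvd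
  have hmul := Nat.mul_le_mul_left (p - 1) hdvd
  rw [mul_add, ha, hb, hab] at hmul
  have := Nat.digit_sum_le p a
  have := Nat.digit_sum_le p b
  have := Nat.digit_sum_le p (a + b)
  omega

theorem digits_sum_pow (p : ℕ) (hp : 1 < p) (n : ℕ) : (Nat.digits p (p ^ n)).sum = 1 := by
  have h := Nat.digits_base_pow_mul (b := p) (k := n) (m := 1) hp one_pos
  rw [mul_one] at h
  rw [h, Nat.digits_of_lt p 1 one_ne_zero hp]
  simp

theorem digits_sum_sum_le (p : ℕ) (hp : p.Prime) {ι : Type*} (s : Finset ι) (f : ι → ℕ) :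
    (Nat.digits p (∑ i ∈ s, f i)).sum ≤ ∑ i ∈ s, (Nat.digits p (f i)).sum :=
  Finset.le_sum_of_subadditive (fun n => (Nat.digits p n).sum) (by simp)
    (digits_sum_add_le p hp) s f

theorem digits_sum_le_sub_one_mul (p k : ℕ) (hp : 1 < p) (hk : k ≠ 0) :
    (Nat.digits p k).sum ≤ (Nat.log p k + 1) * (p - 1) := by
  have h := List.sum_le_card_nsmul (Nat.digits p k) (p - 1) fun d hd =>
    Nat.le_sub_one_of_lt (Nat.digits_lt_base hp hd)
  rwa [Nat.length_digits p k hp hk, smul_eq_mul] at h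

namespace IsSumPowers

variable {p k l : ℕ}

theorem digits_sum_le (hp : p.Prime) (h : IsSumPowers p k l) : (Nat.digits p k).sum ≤ l := by
  obtain ⟨f, rfl⟩ := h
  refine (digits_sum_sum_le p hp _ _).trans ?_
  simp [digits_sum_pow p hp.one_lt]

theorem modEq (hp : 1 ≤ p) (h : IsSumPowers p k l) : k ≡ l [MOD p - 1] := by
  obtain ⟨f, rfl⟩ := h
  have hone : p ≡ 1 [MOD p - 1] := ((Nat.modEq_iff_dvd' hp).mpr dvd_rfl).symm
  have hsum : ∑ t, p ^ f t ≡ ∑ _t : Fin l, 1 [MOD p - 1] :=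
    Nat.ModEq.sum fun t _ => by simpa using hone.pow (f t)
  simpa using hsum

theorem add {k' l' : ℕ} (h : IsSumPowers p k l) (h' : IsSumPowers p k' l') :
    IsSumPowers p (k + k') (l + l') := by
  obtain ⟨f, rfl⟩ := h
  obtain ⟨g, rfl⟩ := h'
  exact ⟨Fin.append f g, by simp [Fin.sum_univ_add]⟩

theorem base_mul (h : IsSumPowers p k l) : IsSumPowers p (p * k) l := by
  obtain ⟨f, rfl⟩ := h
  exact ⟨fun t => f t + 1, by simp [Finset.mul_sum, pow_succ']⟩

theorem ones (p k : ℕ) : IsSumPowers p k k := ⟨fun _ => 0, by simp⟩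

theorem pow (p n : ℕ) : IsSumPowers p (p ^ n) 1 := ⟨fun _ => n, by simp⟩

theorem of_digits_sum_le (hp : 1 < p) (hs : (Nat.digits p k).sum ≤ l) (hlk : l ≤ k)
    (hmod : k ≡ l [MOD p - 1]) : IsSumPowers p k l := by
  induction k using Nat.strong_induction_on generalizing l with
  | _ k ih =>
    rcases Nat.eq_zero_or_pos k with rfl | hk
    · obtain rfl : l = 0 := by omega
      exact ones p 0
    have hdm := Nat.mod_add_div k p
    rw [Nat.digits_def' hp hk, List.sum_cons] at hs
    have hdiv := Nat.div_lt_self hk hp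
    set b := k % p
    set q := k / p
    have hp1 : p * q = (p - 1) * q + q := by
      rw [← Nat.succ_mul]; congr 1; omega
    obtain ⟨r, rfl⟩ := Nat.exists_eq_add_of_le (show b ≤ l by omega)
    obtain ⟨d, hd⟩ := (Nat.modEq_iff_dvd' hlk).mp hmod.symm
    rcases le_total r q with hr | hr
    · have hq : IsSumPowers p q r := by
        refine ih q hdiv (by omega) hr ?_
        have hbq : b + r ≡ b + q [MOD p - 1] := by
          refine hmod.symm.trans ?_
          refine ((Nat.modEq_iff_dvd' (by omega)).mpr ⟨q, ?_⟩).symm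
          omega
        exact (Nat.ModEq.add_left_cancel' b hbq).symm
      rw [← hdm]
      exact (ones p b).add hq.base_mul
    · have hdq : d ≤ q := by
        have hle : (p - 1) * d ≤ (p - 1) * q := by omega
        exact Nat.le_of_mul_le_mul_left hle (by omega)
      obtain ⟨j, hj⟩ := Nat.exists_eq_add_of_le hdq
      have h := ((ones p b).add (ones p d).base_mul).add (ones p (p * j))
      have hpd : p * d = (p - 1) * d + d := by
        rw [← Nat.succ_mul]; congr 1; omega
      have hpq : p * q = p * d + p * j := by rw [hj, mul_add]
      convert h using 1 <;> omega

theorem self_digits_sum (hp : 1 < p) (k : ℕ) : IsSumPowers p k (Nat.digits p k).sum := by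
  induction k using Nat.strong_induction_on with
  | _ k ih =>
    rcases Nat.eq_zero_or_pos k with rfl | hk
    · simpa using ones p 0
    · rw [Nat.digits_def' hp hk, List.sum_cons]
      have h := (ones p (k % p)).add (ih (k / p) (Nat.div_lt_self hk hp)).base_mul
      rwa [Nat.mod_add_div] at h

theorem exists_intermediate (hp : p.Prime) (hl : 1 ≤ l) (hmod : k ≡ l [MOD p - 1])
    (hs : l < (Nat.digits p k).sum) :
    ∃ m, l < m ∧ m < k ∧ IsSumPowers p k m ∧ IsSumPowers p m l := by
  have hp1 := hp.one_lt
  have hk0 : k ≠ 0 := by rintro rfl; simp at hs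
  have hq : (l - 1) % (p - 1) < p - 1 := Nat.mod_lt _ (by omega)
  have hql : (l - 1) % (p - 1) ≤ l - 1 := Nat.mod_le _ _
  have hqm : (l - 1) % (p - 1) ≡ l - 1 [MOD p - 1] := Nat.mod_modEq _ _
  have hpow : p ^ Nat.log p k ≤ k := Nat.pow_log_le_self p hk0
  have hbern : 1 + Nat.log p k * (p - 1) ≤ p ^ Nat.log p k := by
    have h := one_add_mul_le_pow_of_sq_nonneg (R := ℕ) (a := p - 1) (by positivity)
      (by positivity) (by positivity) (Nat.log p k)
    rwa [show 1 + (p - 1) = p by omega, Nat.cast_id] at h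
  have hup := digits_sum_le_sub_one_mul p k hp1 hk0
  generalize (l - 1) % (p - 1) = q at hq hql hqm
  generalize Nat.log p k = n at hpow hbern hup
  have hmq : IsSumPowers p (p ^ n + q) (1 + q) := (pow p n).add (ones p q)
  have hml : p ^ n + q ≡ l [MOD p - 1] := by
    refine (hmq.modEq hp1.le).trans ?_
    have h := hqm.add_left 1
    rwa [show 1 + (l - 1) = l by omega] at h
  have hmk : p ^ n + q < k := by
    by_contra! hle
    have h := ((pow p n).add (ones p (k - p ^ n))).digits_sum_le hp
    rw [show p ^ n + (k - p ^ n) = k by omega] at h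
    omega
  have hsm : (Nat.digits p k).sum ≤ p ^ n + q := by
    by_contra! hlt
    have hcong : p ^ n + q ≡ (Nat.digits p k).sum [MOD p - 1] :=
      hml.trans (hmod.symm.trans ((self_digits_sum hp1 k).modEq hp1.le))
    have h := Nat.le_of_dvd (by omega) ((Nat.modEq_iff_dvd' hlt.le).mp hcong)
    rw [Nat.succ_mul] at hup
    omega
  exact ⟨p ^ n + q, by omega, hmk, of_digits_sum_le hp1 hsm hmk.le (hmod.trans hml.symm),
    of_digits_sum_le hp1 ((hmq.digits_sum_le hp).trans (by omega)) (by omega) hml⟩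

end IsSumPowers

namespace IsPChain

variable {p k l s : ℕ}

theorem modEq (hp : 1 ≤ p) (h : IsPChain p k l s) : k ≡ l [MOD p - 1] := by
  obtain ⟨c, rfl, rfl, -, hc⟩ := h
  have key : ∀ α ≤ s, c α ≡ c 0 [MOD p - 1] := by
    intro α
    induction α with
    | zero => exact fun _ => Nat.ModEq.rfl
    | succ α ih => exact fun hα => ((hc α hα).modEq hp).trans (ih (by omega))
  exact key s le_rfl

theorem one (hlk : l < k) (h : IsSumPowers p k l) : IsPChain p k l 1 := by
  refine ⟨fun α => if α = 0 then l else k, by simp, by simp, ?_, ?_⟩ <;>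
  · intro α hα
    obtain rfl : α = 0 := by omega
    simpa

theorem two {m : ℕ} (hlm : l < m) (hmk : m < k) (hk : IsSumPowers p k m)
    (hm : IsSumPowers p m l) : IsPChain p k l 2 := by
  refine ⟨fun α => if α = 0 then l else if α = 1 then m else k, by simp, by simp, ?_, ?_⟩ <;>
  · intro α hα
    interval_cases α <;> simpa

end IsPChain

/-- For a prime `p` and integers `k > l ≥ 1`:
(1) a chain of `p`-power partitions from `k` to `l` exists iff `p − 1 ∣ k − l`;
(2) if `p − 1 ∣ k − l` and `l ≥ s_p(k)`, the minimal length of such a chain is `1`,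
i.e. `k` is itself a sum of `l` powers of `p`;
(3) if `p − 1 ∣ k − l` and `l < s_p(k)`, the minimal length is `2`, i.e. `k` is not a sum
of `l` powers of `p` but there is `m` with `l < m < k`, `k` a sum of `m` powers of `p`
and `m` a sum of `l` powers of `p`. -/
theorem pchain_classification (p : ℕ) (hp : p.Prime) (k l : ℕ) (hl : 1 ≤ l)
    (hlk : l < k) :
    ((∃ s, 1 ≤ s ∧ IsPChain p k l s) ↔ (p - 1) ∣ (k - l)) ∧
    ((p - 1) ∣ (k - l) → (Nat.digits p k).sum ≤ l → IsSumPowers p k l) ∧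
    ((p - 1) ∣ (k - l) → l < (Nat.digits p k).sum →
      ¬ IsSumPowers p k l ∧
        ∃ m, l < m ∧ m < k ∧ IsSumPowers p k m ∧ IsSumPowers p m l) := by
  have hp1 := hp.one_lt
  have hmod : (p - 1) ∣ (k - l) ↔ k ≡ l [MOD p - 1] :=
    (Nat.modEq_iff_dvd' hlk.le).symm.trans Nat.ModEq.comm
  rw [hmod]
  refine ⟨⟨fun ⟨s, _, h⟩ => h.modEq hp1.le, fun h => ?_⟩,
    fun h hs => .of_digits_sum_le hp1 hs hlk.le h,
    fun h hs => ⟨fun hk => hs.not_ge (hk.digits_sum_le hp),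
      IsSumPowers.exists_intermediate hp hl h hs⟩⟩
  rcases le_or_gt (Nat.digits p k).sum l with hs | hs
  · exact ⟨1, le_rfl, .one hlk (.of_digits_sum_le hp1 hs hlk.le h)⟩
  · obtain ⟨m, hlm, hmk, hk, hm⟩ := IsSumPowers.exists_intermediate hp hl h hs
    exact ⟨2, one_le_two, .two hlm hmk hk hm⟩
end
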